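/- Let μ be a Borel probability measure on ℝ, not a Dirac measure, with m_8(μ) < ∞, m_1(μ) = 0, m_2(μ) = 1 and m_3(μ) = 0. Then there exist a constant c(μ) > 0 and n₁ = n₁(μ) ∈ ℕ such that for all n ≥ n₁: | ∫_ℝ |p_n(x) − p_w(x)| dx − 2|m_4(μ) − 2|/(π n) | ≤ c(μ) n^{−6/5}. -/

import Mathlib

open MeasureTheory Complex Filter Set
open scoped Topology

noncomputable section

namespace FreeCLT

def mom (μ : Measure ℝ) (k : ℕ) : ℝ := ∫ u, u ^ k ∂μ

def cauchy (μ : Measure ℝ) (z : ℂ) : ℂ := ∫ u, (z - (u : ℂ))⁻¹ ∂μ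

def recip (μ : Measure ℝ) (z : ℂ) : ℂ := (cauchy μ z)⁻¹

def MemF (F : ℂ → ℂ) : Prop :=
  ∃ ν : Measure ℝ, IsProbabilityMeasure ν ∧ ∀ z : ℂ, 0 < z.im → F z = recip ν z

def Subord (μ : Measure ℝ) (n : ℕ) (Z : ℂ → ℂ) : Prop :=
  MemF Z ∧ ∀ z : ℂ, 0 < z.im →
    z = (n : ℂ) * Z z - ((n : ℂ) - 1) * recip μ (Z z)

def IsBoxPow (μ : Measure ℝ) (n : ℕ) (Z : ℂ → ℂ) (ν : Measure ℝ) : Prop :=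
  Subord μ n Z ∧ IsProbabilityMeasure ν ∧
    ∀ z : ℂ, 0 < z.im → recip ν z = recip μ (Z z)

def rescale (n : ℕ) (ν : Measure ℝ) : Measure ℝ :=
  ν.map (fun x => x / Real.sqrt n)

def HasDensity (ν : Measure ℝ) (p : ℝ → ℝ) : Prop :=
  Continuous p ∧ (∀ x, 0 ≤ p x) ∧
    ν = MeasureTheory.volume.withDensity (fun x => ENNReal.ofReal (p x))

def aQ (μ : Measure ℝ) (n : ℕ) : ℝ := mom μ 3 / Real.sqrt n
def bQ (μ : Measure ℝ) (n : ℕ) : ℝ := (mom μ 4 - (mom μ 3) ^ 2 - 1) / n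
def dQ (μ : Measure ℝ) (n : ℕ) : ℝ := (mom μ 4 - (mom μ 3) ^ 2) / n
def eQ (μ : Measure ℝ) (n : ℕ) : ℝ := (1 - bQ μ n) / Real.sqrt (1 - dQ μ n)

def pw (x : ℝ) : ℝ := (1 / (2 * Real.pi)) * Real.sqrt (max (4 - x ^ 2) 0)

def truncSet (n : ℕ) : Set ℝ := {u : ℝ | |u| ≤ Real.sqrt ((n : ℝ) - 1) / Real.pi}

def Tfun (W : ℕ → ℂ → ℂ) (n : ℕ) (z : ℂ) : ℂ :=
  W n ((Real.sqrt (n : ℝ) : ℂ) * z) / (Real.sqrt (n : ℝ) : ℂ)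

lemma sub_ne {z : ℂ} (hz : 0 < z.im) (u : ℝ) : z - (u : ℂ) ≠ 0 := by
  intro h
  have := congrArg Complex.im h
  simp at this
  exact hz.ne' this

lemma im_le_norm_sub {z : ℂ} (u : ℝ) : z.im ≤ ‖z - (u : ℂ)‖ := by
  have := Complex.abs_im_le_norm (z - (u : ℂ))
  simp at this
  exact (le_abs_self _).trans this

lemma norm_inv_sub_le {z : ℂ} (hz : 0 < z.im) (u : ℝ) : ‖(z - (u : ℂ))⁻¹‖ ≤ z.im⁻¹ := by
  rw [norm_inv]
  exact inv_anti₀ hz (im_le_norm_sub u)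

lemma cont_inv_sub {z : ℂ} (hz : 0 < z.im) : Continuous (fun u : ℝ => (z - (u : ℂ))⁻¹) :=
  Continuous.inv₀ (by fun_prop) (sub_ne hz)

lemma integrable_inv_sub (ν : Measure ℝ) [IsFiniteMeasure ν] {z : ℂ} (hz : 0 < z.im) :
    Integrable (fun u : ℝ => (z - (u : ℂ))⁻¹) ν :=
  Integrable.of_bound (cont_inv_sub hz).aestronglyMeasurable z.im⁻¹
    (Eventually.of_forall (norm_inv_sub_le hz))

lemma im_inv_sub {z : ℂ} (u : ℝ) :
    ((z - (u : ℂ))⁻¹).im = - (z.im * ‖(z - (u : ℂ))⁻¹‖ ^ 2) := by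
  rw [Complex.inv_im, norm_inv, inv_pow, ← Complex.normSq_eq_norm_sq]
  simp [div_eq_mul_inv]

lemma integrable_sq (ν : Measure ℝ) [IsFiniteMeasure ν] {z : ℂ} (hz : 0 < z.im) :
    Integrable (fun u : ℝ => ‖(z - (u : ℂ))⁻¹‖ ^ 2) ν := by
  refine Integrable.of_bound ((cont_inv_sub hz).norm.pow 2).aestronglyMeasurable (z.im⁻¹ ^ 2)
    (Eventually.of_forall fun u => ?_)
  rw [Real.norm_of_nonneg (by positivity)]
  gcongr
  exact norm_inv_sub_le hz u

lemma im_cauchy (ν : Measure ℝ) [IsFiniteMeasure ν] {z : ℂ} (hz : 0 < z.im) :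
    (cauchy ν z).im = - (z.im * ∫ u : ℝ, ‖(z - (u : ℂ))⁻¹‖ ^ 2 ∂ν) := by
  have h := integral_im (𝕜 := ℂ) (integrable_inv_sub ν hz)
  simp only [RCLike.im_eq_complex_im] at h
  rw [cauchy, ← h]
  simp_rw [im_inv_sub]
  rw [integral_neg, integral_const_mul]

lemma sq_pos' (ν : Measure ℝ) [IsProbabilityMeasure ν] {z : ℂ} (hz : 0 < z.im) :
    0 < ∫ u : ℝ, ‖(z - (u : ℂ))⁻¹‖ ^ 2 ∂ν := by
  rw [integral_pos_iff_support_of_nonneg (fun u => by positivity) (integrable_sq ν hz)]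
  have : Function.support (fun u : ℝ => ‖(z - (u : ℂ))⁻¹‖ ^ 2) = univ := by
    ext u
    simpa using sub_ne hz u
  rw [this]; simp

lemma cauchy_ne (ν : Measure ℝ) [IsProbabilityMeasure ν] {z : ℂ} (hz : 0 < z.im) :
    cauchy ν z ≠ 0 := by
  intro h
  have h1 := im_cauchy ν hz
  have := mul_pos hz (sq_pos' ν hz)
  rw [h] at h1
  simp only [Complex.zero_im] at h1
  linarith

lemma norm_cauchy_sq (ν : Measure ℝ) [IsProbabilityMeasure ν] {z : ℂ} (hz : 0 < z.im) :
    ‖cauchy ν z‖ ^ 2 ≤ ∫ u : ℝ, ‖(z - (u : ℂ))⁻¹‖ ^ 2 ∂ν := by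
  set X : ℝ → ℝ := fun u => ‖(z - (u : ℂ))⁻¹‖ with hX
  have hi : Integrable X ν := (integrable_inv_sub ν hz).norm
  have h1 : ‖cauchy ν z‖ ≤ ∫ u, X u ∂ν := norm_integral_le_integral_norm _
  have h0 : 0 ≤ ∫ u, X u ∂ν := (norm_nonneg _).trans h1
  set m := ∫ u, X u ∂ν
  have h2 : 0 ≤ ∫ u, (X u ^ 2 - 2 * m * X u + m ^ 2) ∂ν :=
    integral_nonneg fun u => by
      have := sq_nonneg (X u - m)
      simp only [Pi.zero_apply]
      nlinarith
  have hs : Integrable (fun u => X u ^ 2) ν := integrable_sq ν hz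
  have hs2 : Integrable (fun u => 2 * m * X u) ν := hi.const_mul _
  have hs3 : Integrable (fun u => X u ^ 2 - 2 * m * X u) ν := hs.sub hs2
  rw [integral_add hs3 (integrable_const _), integral_sub hs hs2, integral_const_mul] at h2
  simp at h2
  have : ‖cauchy ν z‖ ^ 2 ≤ m ^ 2 := by gcongr
  have e : ∫ u, X u ∂ν = m := rfl
  rw [e] at h2
  nlinarith

lemma im_recip (ν : Measure ℝ) [IsProbabilityMeasure ν] {z : ℂ} (hz : 0 < z.im) :
    z.im ≤ (recip ν z).im := by
  rw [recip, Complex.inv_im, Complex.normSq_eq_norm_sq, im_cauchy ν hz, neg_neg]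
  have h := norm_cauchy_sq ν hz
  have h0 : 0 < ‖cauchy ν z‖ := norm_pos_iff.2 (cauchy_ne ν hz)
  rw [le_div_iff₀ (by positivity)]
  gcongr

lemma cont_cauchy (ν : Measure ℝ) [IsProbabilityMeasure ν] {z : ℂ} (hz : 0 < z.im) :
    ContinuousAt (cauchy ν) z := by
  unfold cauchy
  have hev : ∀ᶠ w : ℂ in 𝓝 z, z.im / 2 < w.im :=
    (Complex.continuous_im.tendsto z).eventually (lt_mem_nhds (by linarith))
  refine continuousAt_of_dominated (bound := fun _ => (z.im / 2)⁻¹) ?_ ?_ (integrable_const _) ?_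
  · filter_upwards [hev] with w hw
    exact (cont_inv_sub (by linarith)).aestronglyMeasurable
  · filter_upwards [hev] with w hw
    refine Eventually.of_forall fun u => ?_
    refine (norm_inv_sub_le (by linarith) u).trans ?_
    exact inv_anti₀ (by linarith) hw.le
  · refine Eventually.of_forall fun u => ?_
    exact ContinuousAt.inv₀ (by fun_prop) (sub_ne hz u)

lemma cont_recip (ν : Measure ℝ) [IsProbabilityMeasure ν] {z : ℂ} (hz : 0 < z.im) :
    ContinuousAt (recip ν) z :=
  (cont_cauchy ν hz).inv₀ (cauchy_ne ν hz)

lemma cauchy_rescale (ν : Measure ℝ) {n : ℕ} (hn : 1 ≤ n) {z : ℂ} (hz : 0 < z.im) :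
    cauchy (rescale n ν) z = (Real.sqrt n : ℂ) * cauchy ν ((Real.sqrt n : ℂ) * z) := by
  have hs : (0 : ℝ) < Real.sqrt n := Real.sqrt_pos.2 (by positivity)
  have hs' : (Real.sqrt n : ℂ) ≠ 0 := by exact_mod_cast hs.ne'
  rw [cauchy, rescale, integral_map (by fun_prop) (cont_inv_sub hz).aestronglyMeasurable,
    cauchy, ← integral_const_mul]
  congr 1
  ext u
  have h1 := sub_ne hz (u / Real.sqrt n)
  push_cast at h1 ⊢
  have : z - (u : ℂ) / (Real.sqrt n : ℂ) = ((Real.sqrt n : ℂ) * z - u) / (Real.sqrt n : ℂ) := by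
    field_simp
  rw [this, inv_div, div_eq_mul_inv]

lemma density_facts {ν : Measure ℝ} [IsProbabilityMeasure ν] {p : ℝ → ℝ} (h : HasDensity ν p) :
    Integrable p ∧ ∫ x, p x = 1 := by
  obtain ⟨hc, h0, he⟩ := h
  have h1 : ∫⁻ x, ENNReal.ofReal (p x) = 1 := by
    have := measure_univ (μ := ν)
    rw [he, withDensity_apply _ MeasurableSet.univ] at this
    simpa using this
  have hi : Integrable p := by
    refine ⟨hc.aestronglyMeasurable, ?_⟩
    rw [hasFiniteIntegral_iff_ofReal (Eventually.of_forall h0), h1]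
    simp
  refine ⟨hi, ?_⟩
  rw [integral_eq_lintegral_of_nonneg_ae (Eventually.of_forall h0) hc.aestronglyMeasurable, h1]
  simp

lemma stieltjes {ν : Measure ℝ} [IsProbabilityMeasure ν] {p : ℝ → ℝ} (h : HasDensity ν p) (x : ℝ) :
    Tendsto (fun y : ℝ => - (cauchy ν ((x : ℂ) + y * I)).im) (𝓝[>] 0) (𝓝 (Real.pi * p x)) := by
  obtain ⟨hi, h1⟩ := density_facts h
  obtain ⟨hc, h0, he⟩ := h
  have key := tendsto_integral_comp_smul_smul_of_integrable' (μ := (volume : Measure ℝ))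
    (φ := fun t : ℝ => Real.pi⁻¹ * (1 + t ^ 2)⁻¹) (g := p) (x₀ := x)
    (fun t => by positivity) ?_ ?_ hi hc.continuousAt
  · have k2 := (key.comp tendsto_inv_nhdsGT_zero).const_mul Real.pi
    refine k2.congr' ?_
    filter_upwards [self_mem_nhdsWithin] with y hy
    have hy : 0 < y := hy
    have hz : 0 < ((x : ℂ) + y * I).im := by simpa using hy
    rw [im_cauchy ν hz, neg_neg, he, integral_withDensity_eq_integral_toReal_smul
      (by fun_prop) (by simp), ← integral_const_mul]
    simp only [Function.comp, Module.finrank_self, pow_one, smul_eq_mul]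
    rw [← integral_const_mul]
    congr 1
    ext u
    rw [ENNReal.toReal_ofReal (h0 u), norm_inv, inv_pow, ← Complex.normSq_eq_norm_sq,
      Complex.normSq_apply]
    simp
    have : 0 < y ^ 2 + (x - u) ^ 2 := by positivity
    have : 0 < (x - u) * (x - u) + y * y := by nlinarith
    field_simp
    ring
  · rw [integral_const_mul, integral_univ_inv_one_add_sq]
    field_simp
  · simp only [Module.finrank_self, pow_one]
    have hcb : Tendsto (fun t : ℝ => ‖t‖) (Bornology.cobounded ℝ) atTop :=
      tendsto_norm_cobounded_atTop
    have : Tendsto (fun r : ℝ => Real.pi⁻¹ * r⁻¹) atTop (𝓝 0) := by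
      simpa using tendsto_inv_atTop_zero.const_mul Real.pi⁻¹
    refine squeeze_zero' (Eventually.of_forall fun t => by positivity) ?_ (this.comp hcb)
    filter_upwards [hcb.eventually_gt_atTop 0] with t ht
    simp only [Function.comp]
    rw [mul_left_comm]
    gcongr
    rw [← sq_abs, ← Real.norm_eq_abs]
    rw [← div_eq_mul_inv, div_le_iff₀ (by positivity)]
    field_simp
    nlinarith


def qf (m : ℝ) (T : ℂ) : ℂ := ((m : ℂ) - 1) * (T⁻¹) ^ 3 - T⁻¹

set_option maxHeartbeats 1000000 in
lemma lemD (m K : ℝ) (hK : 0 ≤ K) : ∃ C > 0, ∃ l0 > 0, l0 ≤ 1 ∧ ∀ (l : ℝ) (T r z A : ℂ),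
    0 < l → l ≤ l0 → 1 / 2 ≤ ‖T‖ → ‖T * r‖ ≤ K * l ^ 11 →
    A = 1 + (l : ℂ) ^ 5 * (T⁻¹) ^ 2 + m * (l : ℂ) ^ 10 * (T⁻¹) ^ 4 + r →
    z = T + (((l : ℂ) ^ 5)⁻¹ - 1) * (T - T / A) →
    ‖z - (T + T⁻¹) - (l : ℂ) ^ 5 * qf m T‖ ≤ C * l ^ 6 ∧
    ‖A / T - T⁻¹ - (l : ℂ) ^ 5 * (T⁻¹) ^ 3‖ ≤ C * l ^ 10 := by
  set M := |m| with hM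
  have hM0 : 0 ≤ M := abs_nonneg m
  set c1 := 2 + 8 * M + K with hc1
  set c2 := 8 * M + K with hc2
  have hc10 : 2 ≤ c1 := by linarith
  have hc20 : 0 ≤ c2 := by positivity
  refine ⟨(K + c2 + 2 * c2 * (c1 + 2) + 2 * c1 ^ 2 + 8 * c1 ^ 3) + (32 * M + 4 * K), by positivity,
    (4 * c1)⁻¹, by positivity, ?_, ?_⟩
  · exact inv_le_one_of_one_le₀ (by linarith)
  intro l T r z A hl hl0 hT hr hA hz
  have hl1 : l ≤ 1 := hl0.trans (inv_le_one_of_one_le₀ (by linarith))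
  have hlc : l * (4 * c1) ≤ 1 := by
    have := mul_le_mul_of_nonneg_right hl0 (show 0 ≤ 4 * c1 by linarith)
    rwa [inv_mul_cancel₀ (by linarith)] at this
  have hT0 : T ≠ 0 := by
    intro h; rw [h] at hT; norm_num at hT
  have hlC : (l : ℂ) ≠ 0 := by exact_mod_cast hl.ne'
  set i := T⁻¹ with hi
  have hin : ‖i‖ ≤ 2 := by
    rw [hi, norm_inv]
    have := inv_anti₀ (by norm_num) hT
    norm_num at this; exact this
  set e : ℂ := (l : ℂ) ^ 5 with he
  have hen : ‖e‖ = l ^ 5 := by rw [he, norm_pow, Complex.norm_real, Real.norm_of_nonneg hl.le]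
  have he0 : e ≠ 0 := pow_ne_zero _ hlC
  have he2 : (l : ℂ) ^ 10 = e ^ 2 := by rw [he]; ring
  have hmn : ‖(m : ℂ)‖ = M := by rw [Complex.norm_real]; rfl
  set τ := T * r / e with hτ
  have hτn : ‖τ‖ ≤ K * l ^ 6 := by
    rw [hτ, norm_div, hen, div_le_iff₀ (by positivity)]
    calc _ ≤ _ := hr
      _ = _ := by ring
  have hl65 : l ^ 6 ≤ l ^ 5 := pow_le_pow_of_le_one hl.le hl1 (by norm_num)
  have hl51 : l ^ 5 ≤ l := by simpa using pow_le_pow_of_le_one hl.le hl1 (show 1 ≤ 5 by norm_num)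
  have hl61 : l ^ 6 ≤ 1 := pow_le_one₀ hl.le hl1
  have hl106 : l ^ 10 ≤ l ^ 6 := pow_le_pow_of_le_one hl.le hl1 (by norm_num)
  have hl1110 : l ^ 11 ≤ l ^ 10 := pow_le_pow_of_le_one hl.le hl1 (by norm_num)
  have hi3 : ‖i ^ 3‖ ≤ 8 := by
    rw [norm_pow]; calc _ ≤ (2:ℝ) ^ 3 := by gcongr
      _ = 8 := by norm_num
  set v := m * e * i ^ 3 + τ with hv
  have hvn : ‖v‖ ≤ c2 * l ^ 5 := by
    calc ‖v‖ ≤ ‖m * e * i ^ 3‖ + ‖τ‖ := norm_add_le _ _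
      _ ≤ M * l ^ 5 * 8 + K * l ^ 6 := by
        rw [norm_mul, norm_mul, hmn, hen]; gcongr
      _ ≤ c2 * l ^ 5 := by nlinarith
  set U := i + v with hU
  have hUn : ‖U‖ ≤ c1 := by
    calc ‖U‖ ≤ ‖i‖ + ‖v‖ := norm_add_le _ _
      _ ≤ 2 + c2 * l ^ 5 := by gcongr
      _ ≤ c1 := by nlinarith
  set B := U * i with hB
  have hBn : ‖B‖ ≤ 2 * c1 := by
    rw [hB, norm_mul]
    calc _ ≤ c1 * 2 := by gcongr
      _ = _ := by ring
  have hTi : T * i = 1 := mul_inv_cancel₀ hT0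
  have hAB : A = 1 + e * B := by
    have : e * τ * i = r := by rw [hτ, hi]; field_simp
    rw [hA, hB, hU, hv, he2, ← this]; ring
  have heB : ‖e * B‖ ≤ 1 / 2 := by
    rw [norm_mul, hen]
    calc _ ≤ l * (2 * c1) := by gcongr
      _ ≤ 1 / 2 := by linarith
  have hAn : 1 / 2 ≤ ‖A‖ := by
    have := norm_sub_norm_le (1 : ℂ) (-(e * B))
    rw [norm_neg, sub_neg_eq_add, ← hAB, norm_one] at this
    linarith
  have hA0 : A ≠ 0 := by
    intro h; rw [h] at hAn; norm_num at hAn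
  have hAi : ‖A⁻¹‖ ≤ 2 := by
    rw [norm_inv]
    have := inv_anti₀ (by norm_num) hAn
    norm_num at this; exact this
  have hTB : T * B = U := by rw [hB, mul_left_comm, hTi, mul_one]
  constructor
  · have hz2 : z - T = (1 - e) * U * A⁻¹ := by
      have : T - T / A = e * U * A⁻¹ := by
        field_simp
        rw [hAB, ← hTB]; ring
      rw [hz, this]
      field_simp
      ring
    have hAinv : A⁻¹ = 1 - e * B + e ^ 2 * B ^ 2 * A⁻¹ := by
      field_simp
      rw [hAB]; ring
    have hmain : z - (T + i) - e * qf m T =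
        τ - e * v - e * (v * (U + i) * i) + e ^ 2 * B * U + (1 - e) * e ^ 2 * B ^ 2 * U * A⁻¹ := by
      have h1 : z = T + (1 - e) * U * A⁻¹ := by rw [← hz2]; ring
      have h3 : τ = U - i - m * e * i ^ 3 := by rw [hU, hv]; ring
      have h4 : v = U - i := by rw [hU]; ring
      rw [h1, h3, h4, qf, ← hi]
      rw [hB] at hAinv ⊢
      linear_combination (1 - e) * U * hAinv
    rw [hmain]
    have h1e : ‖1 - e‖ ≤ 2 := by
      calc _ ≤ ‖(1:ℂ)‖ + ‖e‖ := norm_sub_le _ _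
        _ ≤ 2 := by rw [hen, norm_one]; linarith
    have b2 : ‖e * v‖ ≤ c2 * l ^ 10 := by
      rw [norm_mul, hen]
      calc _ ≤ l ^ 5 * (c2 * l ^ 5) := by gcongr
        _ = _ := by ring
    have b3 : ‖e * (v * (U + i) * i)‖ ≤ 2 * c2 * (c1 + 2) * l ^ 10 := by
      rw [norm_mul, norm_mul, norm_mul, hen]
      have : ‖U + i‖ ≤ c1 + 2 := (norm_add_le _ _).trans (by linarith)
      calc _ ≤ l ^ 5 * (c2 * l ^ 5 * (c1 + 2) * 2) := by gcongr
        _ = _ := by ring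
    have b4 : ‖e ^ 2 * B * U‖ ≤ 2 * c1 ^ 2 * l ^ 10 := by
      rw [norm_mul, norm_mul, norm_pow e, hen]
      calc _ ≤ (l ^ 5) ^ 2 * (2 * c1) * c1 := by gcongr
        _ = _ := by ring
    have b5 : ‖(1 - e) * e ^ 2 * B ^ 2 * U * A⁻¹‖ ≤ 16 * c1 ^ 3 * l ^ 10 := by
      rw [norm_mul, norm_mul, norm_mul, norm_mul, norm_pow e, norm_pow B, hen]
      calc _ ≤ 2 * (l ^ 5) ^ 2 * (2 * c1) ^ 2 * c1 * 2 := by gcongr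
        _ = _ := by ring
    have t1 := norm_add_le (τ - e * v - e * (v * (U + i) * i) + e ^ 2 * B * U)
      ((1 - e) * e ^ 2 * B ^ 2 * U * A⁻¹)
    have t2 := norm_add_le (τ - e * v - e * (v * (U + i) * i)) (e ^ 2 * B * U)
    have t3 := norm_sub_le (τ - e * v) (e * (v * (U + i) * i))
    have t4 := norm_sub_le τ (e * v)
    have hl10 : l ^ 10 ≤ l ^ 6 * (1 / 2) := by
      have : l ^ 4 ≤ 1 / 2 := by
        have h41 : l ^ 4 ≤ l := by
          simpa using pow_le_pow_of_le_one hl.le hl1 (show 1 ≤ 4 by norm_num)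
        nlinarith
      calc l ^ 10 = l ^ 6 * l ^ 4 := by ring
        _ ≤ _ := by gcongr
    have s2 : c2 * l ^ 10 ≤ c2 * l ^ 6 := by gcongr
    have s3 : 2 * c2 * (c1 + 2) * l ^ 10 ≤ 2 * c2 * (c1 + 2) * l ^ 6 := by gcongr
    have s4 : 2 * c1 ^ 2 * l ^ 10 ≤ 2 * c1 ^ 2 * l ^ 6 := by gcongr
    have s5 : 16 * c1 ^ 3 * l ^ 10 ≤ 16 * c1 ^ 3 * (l ^ 6 * (1 / 2)) := by gcongr
    have s6 : 0 ≤ (32 * M + 4 * K) * l ^ 6 := by positivity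
    linarith
  · have hm2 : A / T - i - e * i ^ 3 = m * e ^ 2 * i ^ 5 + T * r * i ^ 2 := by
      have : T * r * i ^ 2 = r * i := by
        calc _ = (T * i) * (r * i) := by ring
          _ = _ := by rw [hTi, one_mul]
      rw [this, div_eq_mul_inv, ← hi, hA, he2]; ring
    rw [hm2]
    have b1 : ‖m * e ^ 2 * i ^ 5‖ ≤ 32 * M * l ^ 10 := by
      rw [norm_mul, norm_mul, norm_pow e, norm_pow i, hen, hmn]
      calc _ ≤ M * (l ^ 5) ^ 2 * 2 ^ 5 := by gcongr
        _ = _ := by ring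
    have b2 : ‖T * r * i ^ 2‖ ≤ 4 * K * l ^ 10 := by
      rw [norm_mul, norm_pow]
      calc _ ≤ (K * l ^ 11) * 2 ^ 2 := by gcongr
        _ ≤ (K * l ^ 10) * 2 ^ 2 := by gcongr
        _ = _ := by ring
    have := norm_add_le (m * e ^ 2 * i ^ 5) (T * r * i ^ 2)
    have : 0 ≤ (K + c2 + 2 * c2 * (c1 + 2) + 2 * c1 ^ 2 + 8 * c1 ^ 3) * l ^ 10 := by positivity
    linarith

set_option maxHeartbeats 1000000 in
lemma lemE (C : ℝ) (hC : 0 < C) : ∃ l0 > 0, l0 ≤ 1 ∧ ∀ (l x y : ℝ) (T η : ℂ),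
    0 < l → l ≤ l0 → 1 / 2 ≤ ‖T‖ → l ^ 2 / 10 ≤ T.im → 0 ≤ y → l ^ 4 ≤ 4 - x ^ 2 →
    ‖η‖ ≤ C * l ^ 5 → (x : ℂ) + y * I = T + T⁻¹ + η →
    l ^ 2 / 5 ≤ T.im ∧ 4 / 5 ≤ ‖T‖ := by
  refine ⟨(20 * (C + 1) ^ 2)⁻¹, by positivity, inv_le_one_of_one_le₀ (by nlinarith), ?_⟩
  intro l x y T η hl hl0 hT ht hy hx hη hE
  have hlc : l * (20 * (C + 1) ^ 2) ≤ 1 := by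
    have := mul_le_mul_of_nonneg_right hl0 (show 0 ≤ 20 * (C + 1) ^ 2 by positivity)
    rwa [inv_mul_cancel₀ (by positivity)] at this
  have hl1 : l ≤ 1 / 20 := by nlinarith
  have hlC : l * C ≤ 1 / 20 := by nlinarith
  have hlC2 : l * C ^ 2 ≤ 1 / 20 := by nlinarith
  set q := ‖T‖ ^ 2 with hq
  have hq0 : 0 < q := by positivity
  have hqab : q = T.re ^ 2 + T.im ^ 2 := by
    rw [hq, ← Complex.normSq_eq_norm_sq, Complex.normSq_apply]; ring
  have hre : x = T.re + T.re / q + η.re := by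
    have := congrArg Complex.re hE
    simpa [Complex.inv_re, Complex.normSq_eq_norm_sq] using this
  have him : y = T.im - T.im / q + η.im := by
    have := congrArg Complex.im hE
    simp [Complex.inv_im, Complex.normSq_eq_norm_sq] at this
    rw [this, hq]; ring
  have hηr : |η.re| ≤ C * l ^ 5 := (Complex.abs_re_le_norm η).trans hη
  have hηi : |η.im| ≤ C * l ^ 5 := (Complex.abs_im_le_norm η).trans hη
  have ht0 : 0 < T.im := lt_of_lt_of_le (by positivity) ht
  -- lower bound for q
  have hqq : 16 / 25 ≤ q := by
    by_contra hcon
    push Not at hcon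
    have h1 : T.im * (1 - q) ≤ q * (C * l ^ 5) := by
      have : T.im - T.im / q = y - η.im := by linarith
      have h2 : T.im * (q - 1) = q * (y - η.im) := by
        rw [← this]; field_simp
      have h3 := (abs_le.1 hηi).2
      nlinarith
    have h4 : l ^ 2 / 10 * (9 / 25) ≤ T.im * (1 - q) := by
      apply mul_le_mul ht (by linarith) (by norm_num) ht0.le
    have h5 : q * (C * l ^ 5) ≤ C * l ^ 5 := by
      have : 0 ≤ C * l ^ 5 := by positivity
      nlinarith
    have h6 : C * l ^ 5 ≤ l ^ 2 * (1 / 8000 * 20 / 20) := by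
      have : C * l ^ 5 = l ^ 2 * ((l * C) * l ^ 2) := by ring
      rw [this]
      have : (l * C) * l ^ 2 ≤ 1 / 20 * (1 / 20) ^ 2 := by gcongr
      gcongr
      linarith
    have : 0 < l ^ 2 := by positivity
    nlinarith
  have hTn : 4 / 5 ≤ ‖T‖ := by
    rw [hq] at hqq
    nlinarith [norm_nonneg T]
  refine ⟨?_, hTn⟩
  have hx' : (x - η.re) ^ 2 ≤ 4 - l ^ 4 / 2 := by
    have hx2 : |x| ≤ 2 := by
      rw [← sq_le_sq₀ (abs_nonneg _) (by norm_num), sq_abs]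
      have : 0 < l ^ 4 := by positivity
      linarith
    have h1 : |x * η.re| ≤ 2 * (C * l ^ 5) := by rw [abs_mul]; gcongr
    have h2 : η.re ^ 2 ≤ (C * l ^ 5) ^ 2 := by rw [← sq_abs]; gcongr
    have h3 := neg_abs_le (x * η.re)
    have h4 : C * l ^ 5 ≤ l ^ 4 * (1 / 20) := by
      calc C * l ^ 5 = l ^ 4 * (l * C) := by ring
        _ ≤ _ := by gcongr
    have h5 : (C * l ^ 5) ^ 2 ≤ l ^ 4 * (1 / 20) := by
      calc (C * l ^ 5) ^ 2 = l ^ 4 * ((l * C ^ 2) * l ^ 5) := by ring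
        _ ≤ l ^ 4 * (1 / 20 * 1) := by
          gcongr
          exact pow_le_one₀ hl.le (by linarith)
        _ = _ := by ring
    nlinarith
  have h1 : (x - η.re) * q = T.re * (q + 1) := by
    rw [hre]; field_simp; ring
  have h2 : 4 * T.re ^ 2 ≤ q * (x - η.re) ^ 2 := by
    have h3 : (x - η.re) ^ 2 * q ^ 2 = T.re ^ 2 * (q + 1) ^ 2 := by
      rw [← mul_pow, h1, mul_pow]
    have h4 : T.re ^ 2 * (4 * q) ≤ T.re ^ 2 * (q + 1) ^ 2 := by
      gcongr; nlinarith [sq_nonneg (q - 1)]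
    have h5 : q * (4 * T.re ^ 2) ≤ q * (q * (x - η.re) ^ 2) := by nlinarith
    exact le_of_mul_le_mul_left h5 hq0
  have h3 : q * (x - η.re) ^ 2 ≤ q * (4 - l ^ 4 / 2) := by gcongr
  have h4 : (16 / 25) * l ^ 4 ≤ q * l ^ 4 := by gcongr
  have h5 : (l ^ 2 / 5) ^ 2 ≤ T.im ^ 2 := by
    have : (l ^ 2 / 5) ^ 2 = l ^ 4 / 25 := by ring
    rw [this]
    have : 0 < l ^ 4 := by positivity
    nlinarith
  exact (sq_le_sq₀ (by positivity) ht0.le).1 h5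



set_option maxHeartbeats 1000000 in
lemma lemF (m C : ℝ) (hC : 0 < C) : ∃ C' > 0, ∀ (l θ : ℝ) (T G : ℂ),
    0 < l → l ≤ 1 → l ^ 2 / 2 ≤ Real.sin θ → 1 / 2 ≤ ‖T‖ → ‖T‖ ≤ 6 → 0 ≤ T.im →
    ‖(2 * Real.cos θ : ℂ) - (T + T⁻¹) - (l : ℂ) ^ 5 * qf m T‖ ≤ C * l ^ 6 →
    ‖G - T⁻¹ - (l : ℂ) ^ 5 * (T⁻¹) ^ 3‖ ≤ C * l ^ 10 →
    |-G.im - (Real.sin θ + l ^ 5 * (m - 2) * Real.cos (4 * θ) / (2 * Real.sin θ))|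
      ≤ C' * l ^ 6 / Real.sin θ := by
  set M := |m - 1| with hM
  have hM0 : 0 ≤ M := abs_nonneg _
  obtain ⟨Q, hQ⟩ : ∃ Q, Q = 8 * M + 2 := ⟨_, rfl⟩
  obtain ⟨D, hD⟩ : ∃ D, D = 6 * (Q + C) := ⟨_, rfl⟩
  obtain ⟨L, hL⟩ : ∃ L, L = 14 * M + 2 := ⟨_, rfl⟩
  have hQ0 : 0 < Q := by rw [hQ]; positivity
  have hD0 : 0 < D := by rw [hD]; positivity
  have hL0 : 0 < L := by rw [hL]; positivity
  refine ⟨C + (4 * L * D + 4 * Q * D) + 14 * D + C, by positivity, ?_⟩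
  intro l θ T G hl hl1 hs hT hT6 hTi hz hG
  obtain ⟨s, hsd⟩ : ∃ s, s = Real.sin θ := ⟨_, rfl⟩
  rw [← hsd] at hs ⊢
  have hs0 : 0 < s := lt_of_lt_of_le (by positivity) hs
  have hs1 : s ≤ 1 := by rw [hsd]; exact Real.sin_le_one θ
  have hT0 : T ≠ 0 := by
    intro h; rw [h] at hT; norm_num at hT
  obtain ⟨i, hi⟩ : ∃ i, i = T⁻¹ := ⟨_, rfl⟩
  have hin : ‖i‖ ≤ 2 := by
    rw [hi, norm_inv]
    have := inv_anti₀ (by norm_num) hT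
    norm_num at this; exact this
  obtain ⟨e, he⟩ : ∃ e : ℂ, e = (l : ℂ) ^ 5 := ⟨_, rfl⟩
  have hen : ‖e‖ = l ^ 5 := by rw [he, norm_pow, Complex.norm_real, Real.norm_of_nonneg hl.le]
  -- S and its inverse J
  obtain ⟨S, hS⟩ : ∃ S : ℂ, S = Real.cos θ + Real.sin θ * I := ⟨_, rfl⟩
  obtain ⟨J, hJ⟩ : ∃ J : ℂ, J = Real.cos θ - Real.sin θ * I := ⟨_, rfl⟩
  have hcs : (Real.cos θ : ℂ) ^ 2 + (Real.sin θ : ℂ) ^ 2 = 1 := by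
    have := Real.cos_sq_add_sin_sq θ
    exact_mod_cast this
  have hSJ : S * J = 1 := by
    rw [hS, hJ]
    linear_combination hcs - (Real.sin θ : ℂ) ^ 2 * I_sq
  have hJn : ‖J‖ = 1 := by
    have : ‖J‖ ^ 2 = 1 := by
      rw [← Complex.normSq_eq_norm_sq, Complex.normSq_apply, hJ]
      simp [← Complex.ofReal_cos, ← Complex.ofReal_sin]
      nlinarith [Real.cos_sq_add_sin_sq θ]
    nlinarith [norm_nonneg J]
  have hx : (2 * Real.cos θ : ℂ) = S + J := by rw [hS, hJ]; ring
  have hSi : S - J = 2 * s * I := by rw [hS, hJ, hsd]; ring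
  have hJim : J.im = -s := by rw [hJ, hsd]; simp [← Complex.ofReal_cos, ← Complex.ofReal_sin]
  clear_value M
  obtain ⟨P, hP⟩ : ∃ P, P = T - J := ⟨_, rfl⟩
  have hPn : s ≤ ‖P‖ := by
    have h1 := Complex.abs_im_le_norm P
    have h2 : P.im = T.im + s := by rw [hP, Complex.sub_im, hJim]; ring
    have h3 := le_abs_self P.im
    linarith
  have hP0 : P ≠ 0 := by
    intro h; rw [h, norm_zero] at hPn; linarith
  obtain ⟨P0, hPP⟩ : ∃ P0, P0 = S - J := ⟨_, rfl⟩
  have hP0n : s ≤ ‖P0‖ := by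
    rw [hPP, hSi]
    simp [abs_of_pos hs0]
    linarith
  have hP00 : P0 ≠ 0 := by
    intro h; rw [h, norm_zero] at hP0n; linarith
  have hTi' : T * i = 1 := by rw [hi]; exact mul_inv_cancel₀ hT0
  rw [← hi, ← he] at hz hG
  rw [hx] at hz
  obtain ⟨q, hq⟩ : ∃ q, q = qf m T := ⟨_, rfl⟩
  rw [← hq] at hz
  have hqi : q = ((m : ℂ) - 1) * i ^ 3 - i := by rw [hq, qf, hi]
  obtain ⟨η, hη⟩ : ∃ η, η = S + J - (T + i) - e * q := ⟨_, rfl⟩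
  rw [← hη] at hz
  obtain ⟨Δ, hΔ⟩ : ∃ Δ, Δ = T - S := ⟨_, rfl⟩
  have hΔP : Δ * P = - (T * (e * q + η)) := by
    rw [hη, hΔ, hP]
    linear_combination hSJ - hTi'
  have hij : i - J = (e * q + η) * J * P⁻¹ := by
    have h1 : i - J = - (Δ * i * J) := by
      rw [hΔ]; linear_combination J * hTi' - i * hSJ
    have h2 : Δ = - (T * (e * q + η)) * P⁻¹ := by
      rw [← hΔP]; field_simp
    rw [h1, h2]
    linear_combination ((e * q + η) * J * P⁻¹) * hTi'
  have hmn : ‖(m : ℂ) - 1‖ = M := by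
    rw [hM]
    have : (m : ℂ) - 1 = ((m - 1 : ℝ) : ℂ) := by push_cast; ring
    rw [this, Complex.norm_real]; rfl
  have hqn : ‖q‖ ≤ Q := by
    rw [hqi]
    calc _ ≤ ‖((m : ℂ) - 1) * i ^ 3‖ + ‖i‖ := norm_sub_le _ _
      _ ≤ M * 2 ^ 3 + 2 := by rw [norm_mul, norm_pow, hmn]; gcongr
      _ = Q := by rw [hQ]; ring
  obtain ⟨q0, hq0⟩ : ∃ q0, q0 = ((m : ℂ) - 1) * J ^ 3 - J := ⟨_, rfl⟩
  have hq0n : ‖q0‖ ≤ Q := by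
    rw [hq0]
    calc _ ≤ ‖((m : ℂ) - 1) * J ^ 3‖ + ‖J‖ := norm_sub_le _ _
      _ = M + 1 := by rw [norm_mul, norm_pow, hmn, hJn]; ring
      _ ≤ Q := by rw [hQ]; linarith
  have hl65 : l ^ 6 ≤ l ^ 5 := pow_le_pow_of_le_one hl.le hl1 (by norm_num)
  have hΔn : ‖Δ‖ ≤ D * l ^ 5 / s := by
    rw [le_div_iff₀ hs0]
    calc ‖Δ‖ * s ≤ ‖Δ‖ * ‖P‖ := by gcongr
      _ = ‖T‖ * ‖e * q + η‖ := by rw [← norm_mul, hΔP, norm_neg, norm_mul]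
      _ ≤ 6 * (l ^ 5 * Q + C * l ^ 6) := by
        gcongr
        refine (norm_add_le _ _).trans ?_
        rw [norm_mul, hen]
        gcongr
      _ ≤ 6 * (l ^ 5 * Q + C * l ^ 5) := by gcongr
      _ = D * l ^ 5 := by rw [hD]; ring
  have hijn : ‖i - J‖ ≤ 2 * ‖Δ‖ := by
    have h1 : i - J = - (Δ * i * J) := by
      rw [hΔ]; linear_combination J * hTi' - i * hSJ
    rw [h1, norm_neg, norm_mul, norm_mul, hJn, mul_one]
    calc _ ≤ ‖Δ‖ * 2 := by gcongr
      _ = _ := by ring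
  have hij3 : ‖i ^ 3 - J ^ 3‖ ≤ 14 * ‖Δ‖ := by
    have : i ^ 3 - J ^ 3 = (i - J) * (i ^ 2 + i * J + J ^ 2) := by ring
    rw [this, norm_mul]
    have : ‖i ^ 2 + i * J + J ^ 2‖ ≤ 7 := by
      calc _ ≤ ‖i ^ 2‖ + ‖i * J‖ + ‖J ^ 2‖ := norm_add₃_le
        _ ≤ 2 ^ 2 + 2 * 1 + 1 := by
          rw [norm_pow, norm_pow, norm_mul, hJn]; gcongr; norm_num
        _ = 7 := by norm_num
    calc _ ≤ (2 * ‖Δ‖) * 7 := by gcongr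
      _ = _ := by ring
  have hqq : ‖q - q0‖ ≤ L * ‖Δ‖ := by
    have : q - q0 = ((m : ℂ) - 1) * (i ^ 3 - J ^ 3) - (i - J) := by rw [hqi, hq0]; ring
    rw [this]
    calc _ ≤ ‖((m : ℂ) - 1) * (i ^ 3 - J ^ 3)‖ + ‖i - J‖ := norm_sub_le _ _
      _ ≤ M * (14 * ‖Δ‖) + 2 * ‖Δ‖ := by rw [norm_mul, hmn]; gcongr
      _ = _ := by rw [hL]; ring
  obtain ⟨R, hR⟩ : ∃ R, R = G - i - e * i ^ 3 := ⟨_, rfl⟩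
  rw [← hR] at hG
  have hPinv : ‖P⁻¹‖ ≤ 1 / s := by rw [norm_inv, one_div]; exact inv_anti₀ hs0 hPn
  have hP0inv : ‖P0⁻¹‖ ≤ 1 / s := by rw [norm_inv, one_div]; exact inv_anti₀ hs0 hP0n
  have hmain : G - (J + e * q0 * J * P0⁻¹ + e * J ^ 3) =
      η * J * P⁻¹ + e * J * ((q - q0) * P⁻¹ - q0 * Δ * P⁻¹ * P0⁻¹) + e * (i ^ 3 - J ^ 3) + R := by
    have h1 : P⁻¹ - P0⁻¹ = - Δ * P⁻¹ * P0⁻¹ := by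
      have : Δ = P - P0 := by rw [hΔ, hP, hPP]; ring
      rw [this]; field_simp; ring
    have h2 : G = R + i + e * i ^ 3 := by rw [hR]; ring
    rw [h2]
    linear_combination hij + e * J * q0 * h1
  have hs2 : l ^ 4 ≤ 4 * s ^ 2 := by
    have : (l ^ 2 / 2) ^ 2 ≤ s ^ 2 := by gcongr
    calc l ^ 4 = 4 * (l ^ 2 / 2) ^ 2 := by ring
      _ ≤ _ := by gcongr
  have hl10 : l ^ 10 / s ^ 3 ≤ 4 * l ^ 6 / s := by
    rw [div_le_div_iff₀ (by positivity) hs0]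
    calc l ^ 10 * s = l ^ 6 * s * l ^ 4 := by ring
      _ ≤ l ^ 6 * s * (4 * s ^ 2) := by gcongr
      _ = _ := by ring
  have hl10' : l ^ 10 / s ^ 2 ≤ l ^ 10 / s ^ 3 := by
    apply div_le_div_of_nonneg_left (by positivity) (by positivity)
    exact pow_le_pow_of_le_one hs0.le hs1 (by norm_num)
  have hl106 : l ^ 10 ≤ l ^ 6 := pow_le_pow_of_le_one hl.le hl1 (by norm_num)
  have b1 : ‖η * J * P⁻¹‖ ≤ C * (l ^ 6 / s) := by
    rw [norm_mul, norm_mul, hJn, mul_one]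
    calc _ ≤ (C * l ^ 6) * (1 / s) := by gcongr
      _ = _ := by ring
  have b2 : ‖e * J * ((q - q0) * P⁻¹ - q0 * Δ * P⁻¹ * P0⁻¹)‖ ≤ (4 * L * D + 4 * Q * D) * (l ^ 6 / s) := by
    rw [norm_mul, norm_mul, hJn, mul_one, hen]
    have c1 : ‖(q - q0) * P⁻¹‖ ≤ (L * (D * l ^ 5 / s)) * (1 / s) := by
      rw [norm_mul]
      have : L * ‖Δ‖ ≤ L * (D * l ^ 5 / s) := by gcongr
      have := hqq.trans this
      gcongr
    have c2 : ‖q0 * Δ * P⁻¹ * P0⁻¹‖ ≤ Q * (D * l ^ 5 / s) * (1 / s) * (1 / s) := by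
      rw [norm_mul, norm_mul, norm_mul]
      gcongr
    calc _ ≤ l ^ 5 * ((L * (D * l ^ 5 / s)) * (1 / s) + Q * (D * l ^ 5 / s) * (1 / s) * (1 / s)) := by
          gcongr
          exact (norm_sub_le _ _).trans (add_le_add c1 c2)
      _ = L * D * (l ^ 10 / s ^ 2) + Q * D * (l ^ 10 / s ^ 3) := by field_simp
      _ ≤ L * D * (4 * l ^ 6 / s) + Q * D * (4 * l ^ 6 / s) := by
          exact add_le_add (mul_le_mul_of_nonneg_left (hl10'.trans hl10) (by positivity))
            (mul_le_mul_of_nonneg_left hl10 (by positivity))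
      _ = _ := by ring
  have b3 : ‖e * (i ^ 3 - J ^ 3)‖ ≤ 14 * D * (l ^ 6 / s) := by
    rw [norm_mul, hen]
    calc _ ≤ l ^ 5 * (14 * (D * l ^ 5 / s)) := by
          gcongr
          exact hij3.trans (by gcongr)
      _ = 14 * D * (l ^ 10 / s) := by ring
      _ ≤ _ := by gcongr
  have b4 : ‖R‖ ≤ C * (l ^ 6 / s) := by
    refine hG.trans ?_
    gcongr
    rw [le_div_iff₀ hs0]
    calc l ^ 10 * s ≤ l ^ 6 * 1 := by gcongr
      _ = _ := mul_one _
  have htot : ‖G - (J + e * q0 * J * P0⁻¹ + e * J ^ 3)‖ ≤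
      (C + (4 * L * D + 4 * Q * D) + 14 * D + C) * l ^ 6 / s := by
    rw [hmain]
    refine (norm_add_le _ _).trans ?_
    have := norm_add₃_le (a := η * J * P⁻¹) (b := e * J * ((q - q0) * P⁻¹ - q0 * Δ * P⁻¹ * P0⁻¹))
      (c := e * (i ^ 3 - J ^ 3))
    calc _ ≤ C * (l ^ 6 / s) + (4 * L * D + 4 * Q * D) * (l ^ 6 / s) + 14 * D * (l ^ 6 / s)
          + C * (l ^ 6 / s) := by linarith
      _ = _ := by ring
  refine le_trans ?_ htot
  have hval : J + e * q0 * J * P0⁻¹ + e * J ^ 3 = J + e * ((m : ℂ) - 2) * (J ^ 4 * P0⁻¹) := by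
    have hh : P0⁻¹ * P0 = 1 := inv_mul_cancel₀ hP00
    rw [hq0]
    rw [hPP] at hh ⊢
    linear_combination (-e * J ^ 3) * hh + e * J ^ 2 * (S - J)⁻¹ * hSJ
  have him : (J + e * q0 * J * P0⁻¹ + e * J ^ 3).im
      = -(s + l ^ 5 * (m - 2) * Real.cos (4 * θ) / (2 * s)) := by
    have hJ4 : J ^ 4 = Real.cos (4 * θ) - Real.sin (4 * θ) * I := by
      have h1 : J = Complex.cos (-θ) + Complex.sin (-θ) * I := by
        rw [hJ]; push_cast; rw [Complex.cos_neg, Complex.sin_neg]; ring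
      rw [h1, Complex.cos_add_sin_mul_I_pow]
      push_cast
      rw [show ((4 : ℂ)) * -(θ : ℂ) = -(4 * θ) by ring, Complex.cos_neg, Complex.sin_neg]
      ring
    have hP0i : P0⁻¹ = ((-(1 / (2 * s)) : ℝ) : ℂ) * I := by
      rw [hPP, hSi]
      have : (s : ℂ) ≠ 0 := by exact_mod_cast hs0.ne'
      push_cast
      field_simp
      rw [I_sq]; norm_num
    rw [hval, hJ4, hP0i, Complex.add_im, hJim]
    have h3 : e * ((m : ℂ) - 2) * (((Real.cos (4 * θ) : ℂ) - Real.sin (4 * θ) * I) *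
        (((-(1 / (2 * s)) : ℝ) : ℂ) * I)) =
        ((l ^ 5 * (m - 2) * (Real.sin (4 * θ) * (-(1 / (2 * s)))) : ℝ) : ℂ) +
        ((l ^ 5 * (m - 2) * (Real.cos (4 * θ) * (-(1 / (2 * s)))) : ℝ) : ℂ) * I := by
      rw [he]; push_cast
      linear_combination (-(l : ℂ) ^ 5 * (m - 2) * Complex.sin (4 * θ) * (-(1 / (2 * s)))) * I_sq
    rw [h3, Complex.add_im, Complex.ofReal_im, Complex.im_ofReal_mul, Complex.I_im]
    ring
  have h4 := Complex.abs_im_le_norm (G - (J + e * q0 * J * P0⁻¹ + e * J ^ 3))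
  rw [Complex.sub_im, him] at h4
  have h5 : G.im - -(s + l ^ 5 * (m - 2) * Real.cos (4 * θ) / (2 * s)) =
      -(-G.im - (s + l ^ 5 * (m - 2) * Real.cos (4 * θ) / (2 * s))) := by ring
  rw [h5, abs_neg] at h4
  exact h4


lemma integrable_pow' {μ : Measure ℝ} [IsProbabilityMeasure μ]
    (h8 : Integrable (fun u => u ^ 8) μ) {k : ℕ} (hk : k ≤ 8) : Integrable (fun u : ℝ => u ^ k) μ := by
  refine Integrable.mono' (h8.add (integrable_const (1 : ℝ))) (by fun_prop)
    (Eventually.of_forall fun u => ?_)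
  simp only [Pi.add_apply, norm_pow]
  have h0 : u ^ 8 = ‖u‖ ^ 8 := by
    rw [Real.norm_eq_abs, ← abs_pow, abs_of_nonneg]
    have : u ^ 8 = (u ^ 4) ^ 2 := by ring
    rw [this]; positivity
  rw [h0]
  rcases le_total ‖u‖ 1 with h | h
  · have : ‖u‖ ^ k ≤ 1 := pow_le_one₀ (norm_nonneg _) h
    have : 0 ≤ ‖u‖ ^ 8 := by positivity
    linarith
  · have : ‖u‖ ^ k ≤ ‖u‖ ^ 8 := pow_le_pow_right₀ h hk
    linarith

lemma cauchy_expand {μ : Measure ℝ} [IsProbabilityMeasure μ]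
    (h8 : Integrable (fun u => u ^ 8) μ) (h1 : mom μ 1 = 0) (h2 : mom μ 2 = 1) (h3 : mom μ 3 = 0)
    {W : ℂ} (hW : 0 < W.im) :
    ∃ E : ℂ, ‖E‖ ≤ mom μ 6 / W.im ∧
      W * cauchy μ W = 1 + (W⁻¹) ^ 2 + (mom μ 4 : ℂ) * (W⁻¹) ^ 4 +
        (W⁻¹) ^ 5 * ((mom μ 5 : ℂ) + E) := by
  have hW0 : W ≠ 0 := by intro h; rw [h] at hW; simp at hW
  have hb : ∀ u : ℝ, ‖((u : ℂ) ^ 6 * (W - u)⁻¹)‖ ≤ u ^ 6 * W.im⁻¹ := by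
    intro u
    rw [norm_mul, norm_pow, Complex.norm_real, Real.norm_eq_abs, ← abs_pow,
      abs_of_nonneg (show 0 ≤ u ^ 6 by positivity)]
    gcongr
    exact norm_inv_sub_le hW u
  have hi6 : Integrable (fun u : ℝ => u ^ 6 * W.im⁻¹) μ := (integrable_pow' h8 (by norm_num)).mul_const _
  have hiE : Integrable (fun u : ℝ => (u : ℂ) ^ 6 * (W - u)⁻¹) μ := by
    refine Integrable.mono' hi6 ?_ (Eventually.of_forall hb)
    exact (Continuous.mul (by fun_prop) (cont_inv_sub hW)).aestronglyMeasurable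
  refine ⟨∫ u : ℝ, (u : ℂ) ^ 6 * (W - u)⁻¹ ∂μ, ?_, ?_⟩
  · refine (norm_integral_le_of_norm_le hi6 (Eventually.of_forall hb)).trans ?_
    rw [integral_mul_const, mom, div_eq_mul_inv]
  · have hpt : ∀ u : ℝ, W * (W - u)⁻¹ = (∑ k ∈ Finset.range 6, (W⁻¹) ^ k * ((u ^ k : ℝ) : ℂ)) +
        (W⁻¹) ^ 5 * ((u : ℂ) ^ 6 * (W - u)⁻¹) := by
      intro u
      have := sub_ne hW u
      simp only [Finset.sum_range_succ, Finset.sum_range_zero]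
      push_cast
      field_simp
      ring
    have hik : ∀ k ∈ Finset.range 6, Integrable (fun u : ℝ => (W⁻¹) ^ k * ((u ^ k : ℝ) : ℂ)) μ := by
      intro k hk
      have hk : k < 6 := Finset.mem_range.1 hk
      exact ((integrable_pow' h8 (by omega)).ofReal (𝕜 := ℂ)).const_mul _
    rw [cauchy, ← integral_const_mul]
    simp_rw [hpt]
    rw [integral_add (integrable_finsetSum _ hik) (hiE.const_mul _), integral_finsetSum _ hik,
      integral_const_mul]
    simp_rw [integral_const_mul, integral_complex_ofReal]
    have e : ∀ k, (∫ u, u ^ k ∂μ) = mom μ k := fun k => rfl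
    have e0 : mom μ 0 = 1 := by simp [mom]
    simp only [e, Finset.sum_range_succ, Finset.sum_range_zero, e0, h1, h2, h3]
    push_cast
    ring

lemma setup {μ : Measure ℝ} [IsProbabilityMeasure μ]
    (h8 : Integrable (fun u => u ^ 8) μ) (h1 : mom μ 1 = 0) (h2 : mom μ 2 = 1) (h3 : mom μ 3 = 0) :
    ∃ C > 0, ∃ l0 > 0, l0 ≤ 1 ∧ ∀ (n : ℕ) (l : ℝ) (Z : ℂ → ℂ) (ν : Measure ℝ),
      1 ≤ n → 0 < l → l ≤ l0 → (n : ℝ) * l ^ 5 = 1 → IsBoxPow μ n Z ν →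
      ∃ T : ℂ → ℂ, ∀ z : ℂ, 0 < z.im → z.im ≤ (T z).im ∧ ContinuousAt T z ∧
        (1 / 2 ≤ ‖T z‖ → l ^ 2 / 10 ≤ (T z).im →
          ‖z - (T z + (T z)⁻¹) - (l : ℂ) ^ 5 * qf (mom μ 4) (T z)‖ ≤ C * l ^ 6 ∧
          ‖cauchy (rescale n ν) z - (T z)⁻¹ - (l : ℂ) ^ 5 * ((T z)⁻¹) ^ 3‖ ≤ C * l ^ 10) := by
  have hm6 : 0 ≤ mom μ 6 := integral_nonneg fun u => by simp only [Pi.zero_apply]; positivity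
  obtain ⟨C, hC, l0, hl0, hl01, hD⟩ := lemD (mom μ 4) (16 * (|mom μ 5| + 10 * mom μ 6)) (by positivity)
  refine ⟨C, hC, l0, hl0, hl01, ?_⟩
  intro n l Z ν hn hl hll hnl ⟨⟨⟨σ, hσ, hZσ⟩, hsub⟩, hν, hrec⟩
  have hl1 : l ≤ 1 := hll.trans hl01
  have hn0 : (0 : ℝ) < n := by exact_mod_cast hn
  obtain ⟨sn, hsn⟩ : ∃ sn, sn = Real.sqrt n := ⟨_, rfl⟩
  have hsn0 : 0 < sn := by rw [hsn]; exact Real.sqrt_pos.2 hn0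
  have hsn2 : sn ^ 2 = n := by rw [hsn]; exact Real.sq_sqrt hn0.le
  have hsnC : (sn : ℂ) ≠ 0 := by exact_mod_cast hsn0.ne'
  have hsl : 1 ≤ sn * l ^ 2 := by
    have : 1 ≤ (sn * l ^ 2) ^ 2 := by
      have h : (sn * l ^ 2) ^ 2 * l = 1 := by rw [mul_pow, hsn2]; linear_combination hnl
      by_contra hc
      push Not at hc
      nlinarith [sq_nonneg (sn * l ^ 2)]
    have h0 : 0 ≤ sn * l ^ 2 := by positivity
    nlinarith
  have him : ∀ z : ℂ, ((sn : ℂ) * z).im = sn * z.im := fun z => Complex.im_ofReal_mul _ _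
  refine ⟨fun z => recip σ ((sn : ℂ) * z) / sn, fun z hz => ?_⟩
  have hw : 0 < ((sn : ℂ) * z).im := by rw [him]; positivity
  obtain ⟨W, hWd⟩ : ∃ W, W = recip σ ((sn : ℂ) * z) := ⟨_, rfl⟩
  have hWim := im_recip σ hw
  rw [← hWd, him] at hWim
  have hW0 : 0 < W.im := lt_of_lt_of_le (by positivity) hWim
  have hZW : Z ((sn : ℂ) * z) = W := by rw [hZσ _ hw, hWd]
  simp only [← hWd]
  obtain ⟨T, hT⟩ : ∃ T, T = W / (sn : ℂ) := ⟨_, rfl⟩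
  have hWT : W = sn * T := by rw [hT]; field_simp
  have hWTi : W.im = sn * T.im := by rw [hWT, him]
  rw [← hT]
  refine ⟨?_, ?_, ?_⟩
  · rw [hWTi] at hWim
    exact le_of_mul_le_mul_left hWim hsn0
  · have := cont_recip σ hw
    have h2 : ContinuousAt (fun z : ℂ => (sn : ℂ) * z) z := by fun_prop
    exact (ContinuousAt.comp (f := fun z : ℂ => (sn : ℂ) * z) this h2).div_const _
  intro hTn hTi
  have hTne : T ≠ 0 := by intro h; rw [h] at hTn; norm_num at hTn
  obtain ⟨E, hE, hexp⟩ := cauchy_expand h8 h1 h2 h3 hW0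
  have hcne := cauchy_ne μ hW0
  have hWne : W ≠ 0 := by rw [hWT]; exact mul_ne_zero hsnC hTne
  have hlC : (l : ℂ) ≠ 0 := by exact_mod_cast hl.ne'
  have hsnl : (sn : ℂ) ^ 2 * (l : ℂ) ^ 5 = 1 := by
    have : sn ^ 2 * l ^ 5 = 1 := by rw [hsn2, hnl]
    exact_mod_cast this
  have hsi : ((sn : ℂ)⁻¹) ^ 2 = (l : ℂ) ^ 5 := by
    rw [inv_pow]; exact inv_eq_of_mul_eq_one_right hsnl
  have hWi : W⁻¹ = (sn : ℂ)⁻¹ * T⁻¹ := by rw [hWT, mul_inv]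
  have hW2 : (W⁻¹) ^ 2 = (l : ℂ) ^ 5 * (T⁻¹) ^ 2 := by rw [hWi, mul_pow, hsi]
  have hW4 : (W⁻¹) ^ 4 = (l : ℂ) ^ 10 * (T⁻¹) ^ 4 := by
    calc (W⁻¹) ^ 4 = ((W⁻¹) ^ 2) ^ 2 := by ring
      _ = _ := by rw [hW2]; ring
  have hG : cauchy (rescale n ν) z = (W * cauchy μ W) / T := by
    rw [cauchy_rescale ν hn hz, ← hsn]
    have h := hrec _ hw
    rw [hZW, recip, recip, inv_inj] at h
    rw [h, hWT]; field_simp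
  have hz2 : z = T + (((l : ℂ) ^ 5)⁻¹ - 1) * (T - T / (W * cauchy μ W)) := by
    have h := hsub _ hw
    rw [hZW, recip] at h
    have hnC : (n : ℂ) = ((l : ℂ) ^ 5)⁻¹ := by
      apply eq_inv_of_mul_eq_one_left
      exact_mod_cast hnl
    rw [← hnC]
    have h4 : (cauchy μ W)⁻¹ = sn * (T / (W * cauchy μ W)) := by
      rw [hWT]; rw [hWT] at hcne; field_simp
    have h5 : (sn : ℂ) * z = sn * (n * T - (n - 1) * (T / (W * cauchy μ W))) := by
      rw [h, h4, hWT]; ring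
    have h6 := mul_left_cancel₀ hsnC h5
    linear_combination h6
  rw [hG]
  refine hD l T ((W⁻¹) ^ 5 * ((mom μ 5 : ℂ) + E)) z _ hl hll hTn ?_ ?_ hz2
  · have h5 : T * ((W⁻¹) ^ 5 * ((mom μ 5 : ℂ) + E)) =
        (sn : ℂ)⁻¹ * ((l : ℂ) ^ 10 * (T⁻¹) ^ 4) * ((mom μ 5 : ℂ) + E) := by
      rw [← hW4, hWi]; field_simp
    have hTin : ‖T⁻¹‖ ≤ 2 := by
      rw [norm_inv]
      have := inv_anti₀ (by norm_num) hTn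
      norm_num at this; exact this
    have hsnn : ‖(sn : ℂ)⁻¹‖ ≤ l ^ 2 := by
      rw [norm_inv, Complex.norm_real, Real.norm_of_nonneg hsn0.le]
      rw [inv_le_iff_one_le_mul₀ hsn0]
      linarith
    have hWi10 : 1 / 10 ≤ W.im := by
      rw [hWTi]
      have : sn * (l ^ 2 / 10) ≤ sn * T.im := by gcongr
      linarith
    have hEn : ‖E‖ ≤ 10 * mom μ 6 := by
      refine hE.trans ?_
      rw [div_le_iff₀ hW0]
      nlinarith
    have hmE : ‖(mom μ 5 : ℂ) + E‖ ≤ |mom μ 5| + 10 * mom μ 6 := by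
      refine (norm_add_le _ _).trans ?_
      rw [Complex.norm_real, Real.norm_eq_abs]
      gcongr
    rw [h5, norm_mul, norm_mul, norm_mul, norm_pow, norm_pow, Complex.norm_real,
      Real.norm_of_nonneg hl.le]
    calc _ ≤ l ^ 2 * (l ^ 10 * 2 ^ 4) * (|mom μ 5| + 10 * mom μ 6) := by gcongr
      _ = 16 * (|mom μ 5| + 10 * mom μ 6) * l ^ 12 := by ring
      _ ≤ _ := by
        gcongr 16 * (|mom μ 5| + 10 * mom μ 6) * ?_
        exact pow_le_pow_of_le_one hl.le hl1 (by norm_num)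
  · rw [hexp, hW2, hW4]; ring

lemma bulk {μ : Measure ℝ} [IsProbabilityMeasure μ]
    (h8 : Integrable (fun u => u ^ 8) μ) (h1 : mom μ 1 = 0) (h2 : mom μ 2 = 1) (h3 : mom μ 3 = 0) :
    ∃ C > 0, ∃ l0 > 0, l0 ≤ 1 ∧ ∀ (n : ℕ) (l : ℝ) (Z : ℂ → ℂ) (ν : Measure ℝ) (p : ℝ → ℝ),
      1 ≤ n → 0 < l → l ≤ l0 → (n : ℝ) * l ^ 5 = 1 → IsBoxPow μ n Z ν →
      HasDensity (rescale n ν) p → ∀ θ, l ^ 2 / 2 ≤ Real.sin θ →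
      |Real.pi * p (2 * Real.cos θ) - (Real.sin θ +
        l ^ 5 * (mom μ 4 - 2) * Real.cos (4 * θ) / (2 * Real.sin θ))| ≤ C * l ^ 6 / Real.sin θ := by
  obtain ⟨C, hC, l0, hl0, hl01, hS⟩ := setup h8 h1 h2 h3
  obtain ⟨Q, hQ⟩ : ∃ Q, Q = 8 * |mom μ 4 - 1| + 2 := ⟨_, rfl⟩
  have hQ0 : 0 < Q := by rw [hQ]; positivity
  have hqn : ∀ T : ℂ, 1 / 2 ≤ ‖T‖ → ‖qf (mom μ 4) T‖ ≤ Q := by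
    intro T hT
    have hTin : ‖T⁻¹‖ ≤ 2 := by
      rw [norm_inv]
      have := inv_anti₀ (by norm_num) hT
      norm_num at this; exact this
    have hmn : ‖(mom μ 4 : ℂ) - 1‖ = |mom μ 4 - 1| := by
      have : (mom μ 4 : ℂ) - 1 = ((mom μ 4 - 1 : ℝ) : ℂ) := by push_cast; ring
      rw [this, Complex.norm_real]; rfl
    rw [qf]
    calc _ ≤ ‖((mom μ 4 : ℂ) - 1) * (T⁻¹) ^ 3‖ + ‖T⁻¹‖ := norm_sub_le _ _
      _ ≤ |mom μ 4 - 1| * 2 ^ 3 + 2 := by rw [norm_mul, norm_pow, hmn]; gcongr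
      _ = Q := by rw [hQ]; ring
  obtain ⟨l1, hl1, hl11, hE⟩ := lemE (Q + C) (by positivity)
  obtain ⟨C', hC', hF⟩ := lemF (mom μ 4) (C + 1) (by positivity)
  refine ⟨C', hC', min l0 (min l1 (Q + C)⁻¹), by positivity, (min_le_left _ _).trans hl01, ?_⟩
  intro n l Z ν p hn hl hll hnl hbox hp θ hθ
  have hll0 : l ≤ l0 := hll.trans (min_le_left _ _)
  have hll1 : l ≤ l1 := hll.trans ((min_le_right _ _).trans (min_le_left _ _))
  have hll2 : (Q + C) * l ≤ 1 := by
    have : l ≤ (Q + C)⁻¹ := hll.trans ((min_le_right _ _).trans (min_le_right _ _))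
    calc _ ≤ (Q + C) * (Q + C)⁻¹ := by gcongr
      _ = 1 := mul_inv_cancel₀ (by positivity)
  have hlone : l ≤ 1 := hll0.trans hl01
  have hl65 : l ^ 6 ≤ l ^ 5 := pow_le_pow_of_le_one hl.le hlone (by norm_num)
  have hl51 : l ^ 5 ≤ l := by simpa using pow_le_pow_of_le_one hl.le hlone (show 1 ≤ 5 by norm_num)
  obtain ⟨T, hT⟩ := hS n l Z ν hn hl hll0 hnl hbox
  obtain ⟨x, hx⟩ : ∃ x, x = 2 * Real.cos θ := ⟨_, rfl⟩
  have hs0 : 0 < Real.sin θ := lt_of_lt_of_le (by positivity) hθ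
  have hx4 : l ^ 4 ≤ 4 - x ^ 2 := by
    have h1 : (l ^ 2 / 2) ^ 2 ≤ Real.sin θ ^ 2 := by gcongr
    have h2 := Real.cos_sq_add_sin_sq θ
    rw [hx]; nlinarith
  have hzim : ∀ y : ℝ, ((x : ℂ) + y * I).im = y := by intro y; simp
  have hηn : ∀ z : ℂ, 0 < z.im → 1 / 2 ≤ ‖T z‖ → l ^ 2 / 10 ≤ (T z).im →
      ‖z - (T z + (T z)⁻¹)‖ ≤ (Q + C) * l ^ 5 := by
    intro z hz ha hb
    have h := ((hT z hz).2.2 ha hb).1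
    have h2 := norm_add_le (z - (T z + (T z)⁻¹) - (l : ℂ) ^ 5 * qf (mom μ 4) (T z))
      ((l : ℂ) ^ 5 * qf (mom μ 4) (T z))
    rw [sub_add_cancel] at h2
    refine h2.trans ?_
    rw [norm_mul, norm_pow, Complex.norm_real, Real.norm_of_nonneg hl.le]
    calc _ ≤ C * l ^ 6 + l ^ 5 * Q := by gcongr; exact hqn _ ha
      _ ≤ C * l ^ 5 + l ^ 5 * Q := by gcongr
      _ = _ := by ring
  -- bootstrap
  have hboot : ∀ y : ℝ, 0 < y → y ≤ 1 →
      1 / 2 ≤ ‖T (x + y * I)‖ ∧ l ^ 2 / 10 ≤ (T (x + y * I)).im := by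
    have hl2 : 0 < l ^ 2 := by positivity
    set φ : ℝ → ℝ := fun y => min (‖T (x + y * I)‖ * (l ^ 2 / 5)) (T (x + y * I)).im with hφ
    have hstep : ∀ y : ℝ, 0 < y → l ^ 2 / 10 ≤ φ y → l ^ 2 * (16 / 100) ≤ φ y := by
      intro y hy h
      have ha : 1 / 2 ≤ ‖T (x + y * I)‖ := by
        have := h.trans (min_le_left _ _)
        by_contra hc
        push Not at hc
        nlinarith
      have hb := h.trans (min_le_right _ _)
      have hz : 0 < ((x : ℂ) + y * I).im := by rw [hzim]; exact hy
      obtain ⟨e1, e2⟩ := hE l x y (T (x + y * I)) _ hl hll1 ha hb hy.le hx4 (hηn _ hz ha hb)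
        (by ring)
      refine le_min ?_ ?_
      · nlinarith
      · linarith
    have h1 : l ^ 2 * (12 / 100) < φ 1 := by
      have hz : 0 < ((x : ℂ) + (1 : ℝ) * I).im := by rw [hzim]; norm_num
      have h := (hT _ hz).1
      rw [hzim] at h
      have h' : 1 ≤ ‖T (x + (1 : ℝ) * I)‖ :=
        h.trans ((le_abs_self _).trans (Complex.abs_im_le_norm _))
      have : l ^ 2 ≤ 1 := pow_le_one₀ hl.le hlone
      refine lt_min ?_ ?_
      · nlinarith
      · linarith
    have hφge : ∀ y : ℝ, 0 < y → y ≤ 1 → l ^ 2 * (12 / 100) ≤ φ y := by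
      intro y hy hy1
      by_contra hc
      push Not at hc
      have hcont : ContinuousOn φ (Icc y 1) := by
        intro t ht
        have ht0 : 0 < t := lt_of_lt_of_le hy ht.1
        have hz : 0 < ((x : ℂ) + t * I).im := by rw [hzim]; exact ht0
        have hc1 : ContinuousAt (fun t : ℝ => T ((x : ℂ) + t * I)) t :=
          ContinuousAt.comp (f := fun t : ℝ => (x : ℂ) + t * I) (hT _ hz).2.1 (by fun_prop)
        have hc2 : ContinuousAt (fun t : ℝ => (T ((x : ℂ) + t * I)).im) t :=
          Complex.continuous_im.continuousAt.comp hc1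
        have hc3 : ContinuousAt φ t := (hc1.norm.mul_const _).min hc2
        exact hc3.continuousWithinAt
      obtain ⟨t, ht, hte⟩ := intermediate_value_Icc hy1 hcont ⟨hc.le, h1.le⟩
      have := hstep t (lt_of_lt_of_le hy ht.1) (by rw [hte]; linarith)
      rw [hte] at this
      linarith
    intro y hy hy1
    have h := hφge y hy hy1
    constructor
    · have := h.trans (min_le_left _ _)
      by_contra hc
      push Not at hc
      nlinarith
    · have := h.trans (min_le_right _ _)
      linarith
  have hn0 : (0 : ℝ) < n := by exact_mod_cast hn
  have : IsProbabilityMeasure ν := hbox.2.1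
  have : IsProbabilityMeasure (rescale n ν) :=
    Measure.isProbabilityMeasure_map (by fun_prop)
  have hlim := stieltjes hp x
  have hlim2 := ((hlim.sub_const (Real.sin θ +
        l ^ 5 * (mom μ 4 - 2) * Real.cos (4 * θ) / (2 * Real.sin θ))).abs)
  rw [← hx]
  refine le_of_tendsto hlim2 ?_
  have hl6 : 0 < l ^ 6 := by positivity
  filter_upwards [Ioo_mem_nhdsGT hl6] with y hy
  have hy1 : y ≤ 1 := hy.2.le.trans (pow_le_one₀ hl.le hlone)
  obtain ⟨ha, hb⟩ := hboot y hy.1 hy1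
  have hz : 0 < ((x : ℂ) + y * I).im := by rw [hzim]; exact hy.1
  obtain ⟨k1, k2⟩ := (hT _ hz).2.2 ha hb
  refine hF l θ (T (x + y * I)) _ hl hlone hθ ha ?_ ?_ ?_ (k2.trans ?_)
  · -- upper bound of T
    have hη := hηn _ hz ha hb
    have hη1 : (Q + C) * l ^ 5 ≤ 1 := by
      calc _ ≤ (Q + C) * l := by gcongr
        _ ≤ 1 := hll2
    have hTin : ‖(T (x + y * I))⁻¹‖ ≤ 2 := by
      rw [norm_inv]
      have := inv_anti₀ (by norm_num) ha
      norm_num at this; exact this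
    have hzn : ‖(x : ℂ) + y * I‖ ≤ 3 := by
      refine (norm_add_le _ _).trans ?_
      rw [norm_mul, Complex.norm_I, Complex.norm_real, Complex.norm_real, Real.norm_eq_abs,
        Real.norm_of_nonneg hy.1.le, hx, abs_mul]
      have := Real.abs_cos_le_one θ
      norm_num
      linarith
    have e : T (x + y * I) = (x + y * I) - (T (x + y * I))⁻¹ -
        ((x + y * I) - (T (x + y * I) + (T (x + y * I))⁻¹)) := by ring
    have t1 := norm_sub_le ((x + y * I) - (T (x + y * I))⁻¹)
        ((x + y * I) - (T (x + y * I) + (T (x + y * I))⁻¹))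
    have t2 := norm_sub_le ((x : ℂ) + y * I) (T (x + y * I))⁻¹
    rw [← e] at t1
    linarith
  · exact le_trans (by positivity) hb
  · have hx2 : (2 * Real.cos θ : ℂ) = x := by rw [hx]; push_cast; ring
    have e : (2 * Real.cos θ : ℂ) - (T (x + y * I) + (T (x + y * I))⁻¹) -
        (l : ℂ) ^ 5 * qf (mom μ 4) (T (x + y * I)) =
        ((x + y * I) - (T (x + y * I) + (T (x + y * I))⁻¹) -
        (l : ℂ) ^ 5 * qf (mom μ 4) (T (x + y * I))) - y * I := by
      rw [hx2]; ring
    rw [e]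
    refine (norm_sub_le _ _).trans ?_
    rw [norm_mul, Complex.norm_I, Complex.norm_real, Real.norm_of_nonneg hy.1.le]
    have := hy.2
    linarith
  · gcongr; linarith

lemma subst_cos {g : ℝ → ℝ} (hg : Continuous g) (t : ℝ) :
    ∫ x in (-(2 * Real.cos t))..(2 * Real.cos t), g x =
      ∫ θ in t..(Real.pi - t), g (2 * Real.cos θ) * (2 * Real.sin θ) := by
  have h := intervalIntegral.integral_comp_mul_deriv (a := t) (b := Real.pi - t)
    (f := fun θ => 2 * Real.cos θ) (f' := fun θ => 2 * (-Real.sin θ)) (g := g)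
    (fun x _ => (Real.hasDerivAt_cos x).const_mul 2) (by fun_prop) hg
  simp only [Real.cos_pi_sub, Function.comp] at h
  rw [intervalIntegral.integral_symm, show -(2 * Real.cos t) = 2 * -Real.cos t by ring, ← h,
    ← intervalIntegral.integral_neg]
  congr 1
  ext θ
  ring

lemma pw_cont : Continuous pw := by
  unfold pw
  exact continuous_const.mul (((by fun_prop : Continuous fun x : ℝ => 4 - x ^ 2).max
    continuous_const).sqrt)

lemma pw_nonneg (x : ℝ) : 0 ≤ pw x := by unfold pw; positivity

lemma pw_cos {θ : ℝ} (h : 0 ≤ Real.sin θ) : pw (2 * Real.cos θ) = Real.sin θ / Real.pi := by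
  have : max (4 - (2 * Real.cos θ) ^ 2) 0 = (2 * Real.sin θ) ^ 2 := by
    have e : 4 - (2 * Real.cos θ) ^ 2 = (2 * Real.sin θ) ^ 2 := by
      nlinarith [Real.cos_sq_add_sin_sq θ]
    rw [e, max_eq_left (by positivity)]
  rw [pw, this, Real.sqrt_sq (by positivity)]
  field_simp

lemma pw_zero {x : ℝ} (h : 4 ≤ x ^ 2) : pw x = 0 := by
  rw [pw, max_eq_right (by linarith)]; simp

lemma pw_integral (t : ℝ) (h0 : 0 ≤ t) (h1 : t ≤ Real.pi / 2) :
    ∫ x in (-(2 * Real.cos t))..(2 * Real.cos t), pw x =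
      1 - (2 * t - Real.sin (2 * t)) / Real.pi := by
  rw [subst_cos pw_cont]
  have : ∫ θ in t..(Real.pi - t), pw (2 * Real.cos θ) * (2 * Real.sin θ) =
      ∫ θ in t..(Real.pi - t), (2 / Real.pi) * Real.sin θ ^ 2 := by
    apply intervalIntegral.integral_congr
    intro θ hθ
    rw [uIcc_of_le (by linarith)] at hθ
    have : 0 ≤ Real.sin θ := Real.sin_nonneg_of_nonneg_of_le_pi (by linarith [hθ.1]) (by linarith [hθ.2])
    simp only [pw_cos this]
    ring
  rw [this, intervalIntegral.integral_const_mul, integral_sin_sq, Real.sin_pi_sub, Real.cos_pi_sub,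
    Real.sin_two_mul]
  field_simp
  ring

lemma pw_support : Function.support pw ⊆ Ioc (-2) 2 := by
  intro x hx
  have hlt : x ^ 2 < 4 := by
    by_contra hc
    push Not at hc
    exact hx (pw_zero hc)
  constructor <;> nlinarith

lemma pw_integrable : Integrable pw := by
  refine pw_cont.integrable_of_hasCompactSupport ?_
  exact HasCompactSupport.of_support_subset_isCompact isCompact_Icc
    (pw_support.trans Ioc_subset_Icc_self)

lemma pw_total : ∫ x, pw x = 1 := by
  rw [← intervalIntegral.integral_eq_integral_of_support_subset pw_support]
  have := pw_integral 0 le_rfl (by positivity)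
  simpa using this

lemma abs_cos_four : ∫ θ in (0 : ℝ)..Real.pi, |Real.cos (4 * θ)| = 2 := by
  have hp : Function.Periodic (fun x => |Real.cos x|) Real.pi := by
    intro x; simp [Real.cos_add_pi]
  have hint : ∀ t₁ t₂ : ℝ, IntervalIntegrable (fun x => |Real.cos x|) volume t₁ t₂ := fun _ _ =>
    (Real.continuous_cos.abs).intervalIntegrable _ _
  have h1 := intervalIntegral.integral_comp_mul_left (a := 0) (b := Real.pi)
    (fun x => |Real.cos x|) (show (4 : ℝ) ≠ 0 by norm_num)
  have h2 := hp.intervalIntegral_add_zsmul_eq 4 0 hint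
  have h3 := hp.intervalIntegral_add_eq 0 (-(Real.pi / 2))
  have h4 : ∫ x in (-(Real.pi / 2))..(-(Real.pi / 2) + Real.pi), |Real.cos x| = 2 := by
    have e : -(Real.pi / 2) + Real.pi = Real.pi / 2 := by ring
    rw [e]
    have : ∫ x in (-(Real.pi / 2))..(Real.pi / 2), |Real.cos x| =
        ∫ x in (-(Real.pi / 2))..(Real.pi / 2), Real.cos x := by
      apply intervalIntegral.integral_congr
      intro θ hθ
      rw [uIcc_of_le (by linarith [Real.pi_pos])] at hθ
      exact abs_of_nonneg (Real.cos_nonneg_of_mem_Icc hθ)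
    rw [this, integral_cos]
    simp
    norm_num
  rw [h3, h4] at h2
  rw [h1]
  simp at h2 ⊢
  rw [h2]; norm_num

lemma cos_four : ∫ θ in (0 : ℝ)..Real.pi, Real.cos (4 * θ) = 0 := by
  rw [intervalIntegral.integral_comp_mul_left _ (show (4 : ℝ) ≠ 0 by norm_num), integral_cos]
  have : Real.sin (4 * Real.pi) = 0 := by exact_mod_cast Real.sin_nat_mul_pi 4
  simp [this]

lemma trunc_int {f : ℝ → ℝ} (hf : Continuous f) (hb : ∀ x, |f x| ≤ 1) {t : ℝ} (ht : 0 ≤ t) :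
    |(∫ θ in t..(Real.pi - t), f θ) - ∫ θ in (0 : ℝ)..Real.pi, f θ| ≤ 2 * t := by
  have hi : ∀ a b : ℝ, IntervalIntegrable f volume a b := fun a b => hf.intervalIntegrable a b
  have e1 := intervalIntegral.integral_add_adjacent_intervals (hi 0 t) (hi t (Real.pi - t))
  have e2 := intervalIntegral.integral_add_adjacent_intervals (hi 0 (Real.pi - t)) (hi (Real.pi - t) Real.pi)
  have b1 := intervalIntegral.norm_integral_le_of_norm_le_const (a := 0) (b := t) (f := f) (C := 1)
    (fun x _ => hb x)
  have b2 := intervalIntegral.norm_integral_le_of_norm_le_const (a := Real.pi - t) (b := Real.pi)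
    (f := f) (C := 1) (fun x _ => hb x)
  rw [Real.norm_eq_abs, sub_zero, abs_of_nonneg ht] at b1
  rw [Real.norm_eq_abs, sub_sub_cancel, abs_of_nonneg ht] at b2
  rw [abs_le] at *
  constructor <;> linarith

set_option maxHeartbeats 1000000 in
lemma final_int {p : ℝ → ℝ} (hpc : Continuous p) (hp0 : ∀ x, 0 ≤ p x) (hpi : Integrable p)
    (hp1 : ∫ x, p x = 1) {C κ l : ℝ} (hC : 0 < C) (hl : 0 < l) (hl1 : l ≤ 1 / 2)
    (hb : ∀ θ, l ^ 2 / 2 ≤ Real.sin θ →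
      |Real.pi * p (2 * Real.cos θ) - (Real.sin θ +
        l ^ 5 * κ * Real.cos (4 * θ) / (2 * Real.sin θ))| ≤ C * l ^ 6 / Real.sin θ) :
    |(∫ x, |p x - pw x|) - 2 * |κ| * l ^ 5 / Real.pi| ≤ (2 * (Real.pi * C + 2 * |κ|) + 2) * l ^ 6 := by
  obtain ⟨t, ht⟩ : ∃ t, t = l ^ 2 := ⟨_, rfl⟩
  have hpi3 := Real.pi_gt_three
  have ht0 : 0 < t := by rw [ht]; positivity
  have ht4 : t ≤ 1 / 4 := by
    rw [ht]; calc l ^ 2 ≤ (1 / 2) ^ 2 := by gcongr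
      _ = 1 / 4 := by norm_num
  have htpi : t ≤ Real.pi - t := by linarith
  obtain ⟨K, hK⟩ : ∃ K, K = l ^ 5 * κ / Real.pi := ⟨_, rfl⟩
  have hKabs : |K| = l ^ 5 * |κ| / Real.pi := by
    rw [hK, abs_div, abs_mul, abs_of_pos Real.pi_pos, abs_of_nonneg (by positivity : 0 ≤ l ^ 5)]
  have hKle : 2 * t * |K| ≤ 2 * |κ| * l ^ 6 := by
    rw [hKabs, ht]
    have h1 : l ^ 5 * |κ| / Real.pi ≤ l ^ 5 * |κ| := div_le_self (by positivity) (by linarith)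
    have h2 : l ^ 7 ≤ l ^ 6 := pow_le_pow_of_le_one hl.le (by linarith) (by norm_num)
    calc 2 * l ^ 2 * (l ^ 5 * |κ| / Real.pi) ≤ 2 * l ^ 2 * (l ^ 5 * |κ|) := by gcongr
      _ = 2 * |κ| * l ^ 7 := by ring
      _ ≤ _ := by gcongr
  have hsin : ∀ θ ∈ Icc t (Real.pi - t), t / 2 ≤ Real.sin θ := by
    intro θ hθ
    have key : ∀ s, t ≤ s → s ≤ Real.pi / 2 → t / 2 ≤ Real.sin s := by
      intro s h1 h2
      have h3 := Real.mul_le_sin (show 0 ≤ s by linarith) h2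
      refine le_trans ?_ h3
      have : 1 / 2 ≤ 2 / Real.pi := by
        rw [div_le_div_iff₀ (by norm_num) Real.pi_pos]; linarith [Real.pi_le_four]
      calc t / 2 = 1 / 2 * t := by ring
        _ ≤ 2 / Real.pi * s := by gcongr
    rcases le_total θ (Real.pi / 2) with h | h
    · exact key θ hθ.1 h
    · rw [← Real.sin_pi_sub]
      exact key _ (by linarith [hθ.2]) (by linarith)
  set d : ℝ → ℝ := fun x => p x - pw x with hd
  have hdc : Continuous d := hpc.sub pw_cont
  set h : ℝ → ℝ := fun θ => d (2 * Real.cos θ) * (2 * Real.sin θ) with hh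
  have hhc : Continuous h := by fun_prop
  have hest : ∀ θ ∈ Icc t (Real.pi - t), |h θ - K * Real.cos (4 * θ)| ≤ C * l ^ 6 := by
    intro θ hθ
    have hs := hsin θ hθ
    have hs0 : 0 < Real.sin θ := by linarith
    have hb' := hb θ (by rw [← ht]; exact hs)
    have e : h θ - K * Real.cos (4 * θ) = (2 * Real.sin θ / Real.pi) *
        (Real.pi * p (2 * Real.cos θ) - (Real.sin θ +
        l ^ 5 * κ * Real.cos (4 * θ) / (2 * Real.sin θ))) := by
      simp only [hh, hd, pw_cos hs0.le, hK]
      field_simp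
      ring
    rw [e, abs_mul, abs_of_pos (by positivity)]
    calc _ ≤ (2 * Real.sin θ / Real.pi) * (C * l ^ 6 / Real.sin θ) := by gcongr
      _ = (2 / Real.pi) * (C * l ^ 6) := by field_simp
      _ ≤ 1 * (C * l ^ 6) := by
        gcongr
        rw [div_le_one Real.pi_pos]; linarith
      _ = _ := one_mul _
  have hcc : Continuous fun θ : ℝ => Real.cos (4 * θ) := by fun_prop
  have hi2 : IntervalIntegrable (fun θ => K * Real.cos (4 * θ)) volume t (Real.pi - t) :=
    (by fun_prop : Continuous fun θ : ℝ => K * Real.cos (4 * θ)).intervalIntegrable _ _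
  have hi3 : IntervalIntegrable (fun θ => |K| * |Real.cos (4 * θ)|) volume t (Real.pi - t) :=
    (by fun_prop : Continuous fun θ : ℝ => |K| * |Real.cos (4 * θ)|).intervalIntegrable _ _
  have hlen : |Real.pi - t - t| ≤ Real.pi := by
    rw [abs_of_nonneg (by linarith)]; linarith
  -- signed
  have hD0 : |∫ θ in t..(Real.pi - t), h θ| ≤ (Real.pi * C + 2 * |κ|) * l ^ 6 := by
    have h1 := intervalIntegral.norm_integral_le_of_norm_le_const (a := t) (b := Real.pi - t)
      (f := fun θ => h θ - K * Real.cos (4 * θ)) (C := C * l ^ 6) (fun θ hθ => by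
        rw [uIoc_of_le htpi] at hθ
        exact hest θ ⟨hθ.1.le, hθ.2⟩)
    rw [intervalIntegral.integral_sub (hhc.intervalIntegrable _ _)
      hi2, intervalIntegral.integral_const_mul,
      Real.norm_eq_abs] at h1
    have h2 := trunc_int hcc (fun x => Real.abs_cos_le_one _) ht0.le
    rw [cos_four, sub_zero] at h2
    have h3 : |K * ∫ θ in t..(Real.pi - t), Real.cos (4 * θ)| ≤ 2 * |κ| * l ^ 6 := by
      rw [abs_mul]
      calc _ ≤ |K| * (2 * t) := by gcongr
        _ = 2 * t * |K| := by ring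
        _ ≤ _ := hKle
    have h4 : C * l ^ 6 * |Real.pi - t - t| ≤ C * l ^ 6 * Real.pi := by gcongr
    have h5 := abs_add_le ((∫ θ in t..(Real.pi - t), h θ) - K * ∫ θ in t..(Real.pi - t), Real.cos (4 * θ))
      (K * ∫ θ in t..(Real.pi - t), Real.cos (4 * θ))
    rw [sub_add_cancel] at h5
    linarith
  -- absolute
  have hD1 : |(∫ θ in t..(Real.pi - t), |h θ|) - (2 * |K|)| ≤ (Real.pi * C + 2 * |κ|) * l ^ 6 := by
    have h1 := intervalIntegral.norm_integral_le_of_norm_le_const (a := t) (b := Real.pi - t)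
      (f := fun θ => |h θ| - |K| * |Real.cos (4 * θ)|) (C := C * l ^ 6) (fun θ hθ => by
        rw [uIoc_of_le htpi] at hθ
        rw [← abs_mul]
        exact (abs_abs_sub_abs_le_abs_sub _ _).trans (hest θ ⟨hθ.1.le, hθ.2⟩))
    rw [intervalIntegral.integral_sub (hhc.abs.intervalIntegrable _ _)
      hi3, intervalIntegral.integral_const_mul,
      Real.norm_eq_abs] at h1
    have h2 := trunc_int hcc.abs (fun x => by rw [abs_abs]; exact Real.abs_cos_le_one _) ht0.le
    rw [abs_cos_four] at h2
    have h3 : |(|K| * ∫ θ in t..(Real.pi - t), |Real.cos (4 * θ)|) - (2 * |K|)| ≤ 2 * |κ| * l ^ 6 := by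
      have e : (|K| * ∫ θ in t..(Real.pi - t), |Real.cos (4 * θ)|) - 2 * |K| =
        |K| * ((∫ θ in t..(Real.pi - t), |Real.cos (4 * θ)|) - 2) := by ring
      rw [e, abs_mul, abs_abs]
      calc _ ≤ |K| * (2 * t) := by gcongr
        _ = 2 * t * |K| := by ring
        _ ≤ _ := hKle
    have h4 : C * l ^ 6 * |Real.pi - t - t| ≤ C * l ^ 6 * Real.pi := by gcongr
    have h5 := abs_sub_le (∫ θ in t..(Real.pi - t), |h θ|)
      (|K| * ∫ θ in t..(Real.pi - t), |Real.cos (4 * θ)|) (2 * |K|)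
    linarith
  obtain ⟨a, ha⟩ : ∃ a, a = 2 * Real.cos t := ⟨_, rfl⟩
  have ha0 : 0 ≤ a := by
    rw [ha]
    have := Real.cos_nonneg_of_mem_Icc (x := t) ⟨by linarith, by linarith⟩
    linarith
  have hs1 := subst_cos hdc t
  have hs2 := subst_cos hdc.abs t
  have habs : ∫ θ in t..(Real.pi - t), |d (2 * Real.cos θ)| * (2 * Real.sin θ) =
      ∫ θ in t..(Real.pi - t), |h θ| := by
    apply intervalIntegral.integral_congr
    intro θ hθ
    rw [uIcc_of_le htpi] at hθ
    have := hsin θ hθ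
    simp only [hh]
    rw [abs_mul, abs_of_nonneg (show 0 ≤ 2 * Real.sin θ by linarith)]
  rw [habs] at hs2
  have hpwI := pw_integral t ht0.le (by linarith)
  rw [← ha] at hs1 hs2 hpwI
  have hdi : Integrable d := hpi.sub pw_integrable
  have hle : -a ≤ a := by linarith
  rw [intervalIntegral.integral_of_le hle] at hs1 hs2 hpwI
  set S := Ioc (-a) a with hS
  have hSm : MeasurableSet S := measurableSet_Ioc
  have split := integral_add_compl hSm hdi.abs
  have splitp := integral_add_compl hSm hpi
  have splitw := integral_add_compl hSm pw_integrable
  rw [hp1] at splitp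
  rw [pw_total] at splitw
  have hdS : ∫ x in S, d x = (∫ x in S, p x) - ∫ x in S, pw x :=
    integral_sub hpi.integrableOn pw_integrable.integrableOn
  have hrest0 : 0 ≤ ∫ x in Sᶜ, |d x| := integral_nonneg fun x => abs_nonneg _
  have hrest : ∫ x in Sᶜ, |d x| ≤ (∫ x in Sᶜ, p x) + ∫ x in Sᶜ, pw x := by
    rw [← integral_add hpi.integrableOn pw_integrable.integrableOn]
    apply integral_mono hdi.abs.integrableOn (hpi.add pw_integrable).integrableOn
    intro x
    have h1 := hp0 x
    have h2 := pw_nonneg x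
    simp only [hd, Pi.add_apply]
    rw [abs_le]; constructor <;> linarith
  have hcube : (2 * t - Real.sin (2 * t)) / Real.pi ≤ l ^ 6 := by
    have h1 := Real.sin_gt_sub_cube (x := 2 * t) (by linarith)
    rw [div_le_iff₀ Real.pi_pos]
    have h2 : l ^ 6 = t ^ 3 := by rw [ht]; ring
    rw [h2]
    have : 0 < t ^ 3 := by positivity
    nlinarith
  have hval : 2 * |κ| * l ^ 5 / Real.pi = 2 * |K| := by rw [hKabs]; ring
  rw [hval]
  have e1 : ∫ x, |p x - pw x| = ∫ x, |d x| := rfl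
  rw [e1, ← split, hs2]
  have hl6 : 0 < l ^ 6 := by positivity
  rw [abs_le] at hD0 hD1 ⊢
  have hh2 : ∫ x in S, d x = ∫ θ in t..(Real.pi - t), h θ := hs1
  constructor
  · linarith
  · linarith

theorem stmt_2
    (μ : Measure ℝ) [IsProbabilityMeasure μ]
    (hnotdirac : ¬ ∃ c : ℝ, μ = Measure.dirac c)
    (h8 : Integrable (fun u => u ^ 8) μ)
    (h1 : mom μ 1 = 0) (h2 : mom μ 2 = 1)
    (Z : ℕ → ℂ → ℂ) (ν : ℕ → Measure ℝ)
    (hbox : ∀ n : ℕ, 1 ≤ n → IsBoxPow μ n (Z n) (ν n))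
    (p : ℕ → ℝ → ℝ)
    (hp : ∀ᶠ n in atTop, HasDensity (rescale n (ν n)) (p n))
    (h3 : mom μ 3 = 0) :
    ∃ c : ℝ, 0 < c ∧ ∃ n₁ : ℕ, ∀ n : ℕ, n₁ ≤ n →
      |(∫ x : ℝ, |p n x - pw x|) - 2 * |mom μ 4 - 2| / (Real.pi * n)|
        ≤ c * (n : ℝ) ^ (-(6 / 5 : ℝ)) := by
  obtain ⟨C, hC, l0, hl0, hl01, hB⟩ := bulk h8 h1 h2 h3
  refine ⟨2 * (Real.pi * C + 2 * |mom μ 4 - 2|) + 2, by positivity, ?_⟩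
  have hlim : Tendsto (fun n : ℕ => (n : ℝ) ^ (-(1 / 5 : ℝ))) atTop (𝓝 0) :=
    (tendsto_rpow_neg_atTop (by norm_num)).comp tendsto_natCast_atTop_atTop
  have hev := hlim.eventually (gt_mem_nhds (show 0 < min l0 (1 / 2) by positivity))
  obtain ⟨n₁, hn₁⟩ := eventually_atTop.1 ((hp.and hev).and (eventually_ge_atTop 1))
  refine ⟨n₁, fun n hn => ?_⟩
  obtain ⟨⟨hpn, hln⟩, hn1⟩ := hn₁ n hn
  have hn0 : (0 : ℝ) < n := by exact_mod_cast hn1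
  obtain ⟨l, hl⟩ : ∃ l, l = (n : ℝ) ^ (-(1 / 5 : ℝ)) := ⟨_, rfl⟩
  rw [← hl] at hln
  have hlpos : 0 < l := by rw [hl]; positivity
  have hl5 : l ^ 5 = (n : ℝ)⁻¹ := by
    rw [hl, ← Real.rpow_natCast, ← Real.rpow_mul hn0.le, ← Real.rpow_neg_one]
    norm_num
  have hl6 : l ^ 6 = (n : ℝ) ^ (-(6 / 5 : ℝ)) := by
    rw [hl, ← Real.rpow_natCast, ← Real.rpow_mul hn0.le]
    norm_num
  have hnl : (n : ℝ) * l ^ 5 = 1 := by rw [hl5]; exact mul_inv_cancel₀ hn0.ne'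
  have hpr : IsProbabilityMeasure (ν n) := (hbox n hn1).2.1
  have hpr2 : IsProbabilityMeasure (rescale n (ν n)) :=
    Measure.isProbabilityMeasure_map (by fun_prop)
  obtain ⟨hpi, hp1⟩ := density_facts hpn
  have hfin := final_int hpn.1 hpn.2.1 hpi hp1 (κ := mom μ 4 - 2) hC hlpos
    (hln.le.trans (min_le_right _ _))
    (hB n l (Z n) (ν n) (p n) hn1 hlpos (hln.le.trans (min_le_left _ _)) hnl (hbox n hn1) hpn)
  rw [← hl6]
  have e : 2 * |mom μ 4 - 2| / (Real.pi * n) = 2 * |mom μ 4 - 2| * l ^ 5 / Real.pi := by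
    rw [hl5]; field_simp
  rw [e]
  exact hfin

end FreeCLT
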